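/- Let X and Y be real-valued random variables on a common probability space that are equal in distribution, and suppose that the positive part max(Y−X, 0) is integrable. Then Y−X is integrable and E[Y−X] = 0. -/

import Mathlib

open MeasureTheory

/-- truncation -/
noncomputable def truncN (n : ℕ) (x : ℝ) : ℝ := max (-(n:ℝ)) (min n x)

lemma truncN_meas (n : ℕ) : Measurable (truncN n) := by
  unfold truncN; fun_prop

lemma truncN_abs (n : ℕ) (x : ℝ) : |truncN n x| ≤ n := by
  have : (0:ℝ) ≤ n := n.cast_nonneg
  rw [abs_le]
  exact ⟨le_max_left _ _, max_le (by linarith) (min_le_left _ _)⟩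

lemma truncN_lip (n : ℕ) (x y : ℝ) : |truncN n y - truncN n x| ≤ |y - x| := by
  unfold truncN
  refine (abs_max_sub_max_le_max _ _ _ _).trans ?_
  simp only [sub_self, abs_zero]
  refine max_le (abs_nonneg _) ((abs_min_sub_min_le_max _ _ _ _).trans ?_)
  simp

lemma truncN_mono (n : ℕ) : Monotone (truncN n) := by
  intro x y h; unfold truncN; gcongr

lemma truncN_pos (n : ℕ) (x y : ℝ) :
    max (truncN n y - truncN n x) 0 ≤ max (y - x) 0 := by
  rcases le_total x y with h | h
  · refine max_le_max ?_ le_rfl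
    have := truncN_lip n x y
    rw [abs_of_nonneg (sub_nonneg.2 h)] at this
    exact (le_abs_self _).trans this
  · have := truncN_mono n h
    exact max_le ((sub_nonpos.2 this).trans (le_max_right _ _)) (le_max_right _ _)

lemma truncN_tendsto (x : ℝ) : Filter.Tendsto (fun n => truncN n x) Filter.atTop (nhds x) := by
  obtain ⟨N, hN⟩ := exists_nat_ge |x|
  refine tendsto_const_nhds.congr' ?_
  filter_upwards [Filter.eventually_ge_atTop N] with n hn
  have h : |x| ≤ n := hN.trans (by exact_mod_cast hn)
  rw [abs_le] at h
  unfold truncN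
  rw [min_eq_right h.2, max_eq_right h.1]

theorem stationary_increments
    {Ω : Type*} [MeasurableSpace Ω] (P : Measure Ω) [IsProbabilityMeasure P]
    (X Y : Ω → ℝ) (hX : Measurable X) (hY : Measurable Y)
    (hdist : P.map X = P.map Y)
    (hint : Integrable (fun ω => max (Y ω - X ω) 0) P) :
    Integrable (fun ω => Y ω - X ω) P ∧ ∫ ω, (Y ω - X ω) ∂P = 0 := by
  have hTi : ∀ n (Z : Ω → ℝ), Measurable Z → Integrable (fun ω => truncN n (Z ω)) P :=
    fun n Z hZ => Integrable.of_bound ((truncN_meas n).comp hZ).aestronglyMeasurable (n:ℝ)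
      (Filter.Eventually.of_forall fun ω => truncN_abs n _)
  have hDi : ∀ n, Integrable (fun ω => truncN n (Y ω) - truncN n (X ω)) P :=
    fun n => (hTi n Y hY).sub (hTi n X hX)
  have hD0 : ∀ n, ∫ ω, (truncN n (Y ω) - truncN n (X ω)) ∂P = 0 := by
    intro n
    rw [integral_sub (hTi n Y hY) (hTi n X hX),
      ← integral_map hY.aemeasurable (truncN_meas n).aestronglyMeasurable,
      ← integral_map hX.aemeasurable (truncN_meas n).aestronglyMeasurable, hdist, sub_self]
  have hlim : ∀ ω, Filter.Tendsto (fun n => truncN n (Y ω) - truncN n (X ω)) Filter.atTop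
      (nhds (Y ω - X ω)) := fun ω => (truncN_tendsto _).sub (truncN_tendsto _)
  have hbd : ∀ n, ∫ ω, ‖truncN n (Y ω) - truncN n (X ω)‖ ∂P ≤
      2 * ∫ ω, max (Y ω - X ω) 0 ∂P := by
    intro n
    have h1 : ∫ ω, ‖truncN n (Y ω) - truncN n (X ω)‖ ∂P ≤
        ∫ ω, (2 * max (Y ω - X ω) 0 - (truncN n (Y ω) - truncN n (X ω))) ∂P := by
      refine integral_mono (hDi n).norm ((hint.const_mul 2).sub (hDi n)) fun ω => ?_
      have := truncN_pos n (X ω) (Y ω)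
      simp only [Real.norm_eq_abs]
      generalize truncN n (Y ω) - truncN n (X ω) = d at *
      rcases le_total d 0 with h | h
      · rw [abs_of_nonpos h]
        linarith [le_max_right (Y ω - X ω) 0]
      · rw [abs_of_nonneg h]
        linarith [le_max_left d 0]
    rwa [integral_sub (hint.const_mul 2) (hDi n), hD0, sub_zero, integral_const_mul] at h1
  have hI : Integrable (fun ω => Y ω - X ω) P := by
    refine ⟨(hY.sub hX).aestronglyMeasurable, ?_⟩
    rw [hasFiniteIntegral_iff_enorm]
    have hF : ∫⁻ ω, ‖Y ω - X ω‖ₑ ∂P ≤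
        Filter.liminf (fun n => ∫⁻ ω, ‖truncN n (Y ω) - truncN n (X ω)‖ₑ ∂P) Filter.atTop := by
      refine le_trans (le_of_eq ?_) (lintegral_liminf_le fun n =>
        (((truncN_meas n).comp hY).sub ((truncN_meas n).comp hX)).enorm)
      exact lintegral_congr fun ω => ((hlim ω).enorm.liminf_eq).symm
    refine (hF.trans ?_).trans_lt
      (ENNReal.ofReal_lt_top (r := 2 * ∫ ω, max (Y ω - X ω) 0 ∂P))
    refine Filter.liminf_le_of_le (by isBoundedDefault) fun b hb => ?_
    obtain ⟨n, hn⟩ := hb.exists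
    refine hn.trans ?_
    rw [← ofReal_integral_norm_eq_lintegral_enorm (hDi n)]
    exact ENNReal.ofReal_le_ofReal (hbd n)
  refine ⟨hI, ?_⟩
  have := tendsto_integral_of_dominated_convergence (fun ω => ‖Y ω - X ω‖)
    (fun n => (hDi n).aestronglyMeasurable) hI.norm
    (fun n => Filter.Eventually.of_forall fun ω => truncN_lip n (X ω) (Y ω))
    (Filter.Eventually.of_forall hlim)
  simp only [hD0] at this
  exact (tendsto_nhds_unique this tendsto_const_nhds)
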